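/- Let n ≥ 4 and let β = (β_1, ..., β_ℓ) be a pseudo-composition of n. The number of even signed permutations w ∈ D_n with descent set D(w) ⊆ D(β) equals: 2^{n-1}·n!/(β_1!⋯β_ℓ!) if β_1 = 0; 2^{n-1}·n!/((1+β_2)! β_3! ⋯ β_ℓ!) if β_1 = 1; and 2^{n-β_1}·n!/(β_1!⋯β_ℓ!) if β_1 > 1. -/

import Mathlib

/-- Signed permutations of `[n]`: bijections `w` of `ℤ` with `w(-i) = -w(i)` that fix
all integers of absolute value greater than `n`.  These form the hyperoctahedral
group `Bₙ`. -/
def SignedPerms (n : ℕ) : Set (ℤ → ℤ) :=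
  {w | Function.Bijective w ∧ (∀ i : ℤ, w (-i) = -w i) ∧ ∀ i : ℤ, (n : ℤ) < |i| → w i = i}

/-- The type B descent set `D(w) = {i ∈ {0,…,n-1} : w(i) > w(i+1)}` (note `w(0) = 0`
automatically). -/
def DesB (n : ℕ) (w : ℤ → ℤ) : Set ℕ :=
  {i | i < n ∧ w ((i : ℤ) + 1) < w (i : ℤ)}

/-- A pseudo-composition of `n`: a sequence `(β₁, …, β_ℓ)` with `β₁ ≥ 0`,
`β₂, …, β_ℓ > 0` and `β₁ + ⋯ + β_ℓ = n`. -/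
structure PseudoComposition (n : ℕ) where
  parts : List ℕ
  ne_nil : parts ≠ []
  tail_pos : ∀ i ∈ parts.tail, 0 < i
  sum_eq : parts.sum = n

/-- The descent set `D(β) = {β₁, β₁+β₂, …, β₁+⋯+β_{ℓ-1}} ⊆ {0,…,n-1}` of a
pseudo-composition. -/
def DsetB {n : ℕ} (β : PseudoComposition n) : Set ℕ :=
  {m | ∃ i, 0 < i ∧ i < β.parts.length ∧ (β.parts.take i).sum = m}

/-- The type B ribbon number `r^B_α = |{w ∈ Bₙ : D(w) = D(α)}|`. -/
noncomputable def ribbonB {n : ℕ} (α : PseudoComposition n) : ℕ :=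
  Set.ncard {w ∈ SignedPerms n | DesB n w = DsetB α}
/-- Even signed permutations of [n]: those with an even number of negative values
among w(1), ..., w(n).  These form the group D_n. -/
def EvenSignedPerms (n : ℕ) : Set (ℤ → ℤ) :=
  {w | w ∈ SignedPerms n ∧
    Even (((Finset.Icc (1 : ℤ) (n : ℤ)).filter fun i => w i < 0).card)}

/-- The type D descent set, using the convention w(0) := -w(2). -/
def DesD (n : ℕ) (w : ℤ → ℤ) : Set ℕ :=
  {i | i < n ∧ w ((i : ℤ) + 1) < (if i = 0 then -(w 2) else w (i : ℤ))}

/-- The set of proper partial sums of a list of natural numbers. -/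
def properPartialSums (L : List ℕ) : Set ℕ :=
  {m | ∃ i, 0 < i ∧ i < L.length ∧ (L.take i).sum = m}

/-- A word `u` of length `n` whose descents (positions counted from `1`) all lie in `S`. -/
def DescentsIn {n : ℕ} (S : Set ℕ) (u : Fin n → ℤ) : Prop :=
  ∀ (i : ℕ) (h : i + 1 < n), i + 1 ∉ S → u ⟨i, by omega⟩ ≤ u ⟨i + 1, h⟩

section Composition

variable {n : ℕ} (c : Composition n)

lemma Composition.index_mono : Monotone c.index := by
  intro i j hij
  by_contra! h
  have h1 := c.lt_sizeUpTo_index_succ j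
  have h2 := c.sizeUpTo_index_le i
  have h3 : c.sizeUpTo (c.index j).succ ≤ c.sizeUpTo (c.index i) := by
    apply c.monotone_sizeUpTo
    simpa [Nat.succ_le_iff] using h
  have : (i : ℕ) ≤ j := hij
  omega

lemma Composition.index_lt_index_succ_iff (i : ℕ) (h : i + 1 < n) :
    c.index ⟨i, by omega⟩ < c.index ⟨i + 1, h⟩ ↔ i + 1 ∈ properPartialSums c.blocks := by
  constructor
  · intro hlt
    refine ⟨c.index ⟨i + 1, h⟩, lt_of_le_of_lt (Nat.zero_le _) (Fin.lt_def.1 hlt),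
      (c.index ⟨i + 1, h⟩).2, ?_⟩
    change c.sizeUpTo _ = _
    have h1 := c.lt_sizeUpTo_index_succ ⟨i, by omega⟩
    have h2 := c.sizeUpTo_index_le ⟨i + 1, h⟩
    have h3 : c.sizeUpTo (c.index ⟨i, by omega⟩).succ ≤ c.sizeUpTo (c.index ⟨i + 1, h⟩) := by
      apply c.monotone_sizeUpTo
      simpa [Nat.succ_le_iff] using hlt
    simp only at h1 h2
    omega
  · rintro ⟨k, hk0, hk, hs⟩
    change c.sizeUpTo k = i + 1 at hs
    have h1 := c.sizeUpTo_index_le ⟨i, by omega⟩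
    have h2 := c.lt_sizeUpTo_index_succ ⟨i + 1, h⟩
    simp only at h1 h2
    rw [Fin.lt_def]
    have h3 : k ≤ c.index ⟨i + 1, h⟩ := by
      by_contra! hc
      have := c.monotone_sizeUpTo (Nat.succ_le_of_lt hc)
      simp only [Fin.val_succ, Nat.succ_eq_add_one] at *
      omega
    have h4 : (c.index ⟨i, by omega⟩ : ℕ) < k := by
      by_contra! hc
      have := c.monotone_sizeUpTo hc
      omega
    omega

lemma Composition.card_index_fiber (i : Fin c.length) :
    Fintype.card {a // c.index a = i} = c.blocksFun i := by
  rw [← Fintype.card_fin (c.blocksFun i)]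
  refine Fintype.card_congr (Equiv.ofBijective
    (fun j : Fin (c.blocksFun i) => (⟨c.embedding i j, c.index_embedding i j⟩ :
      {a // c.index a = i})) ⟨fun a b hab => ?_, fun a => ?_⟩).symm
  · exact (c.embedding i).injective (congrArg Subtype.val hab)
  · obtain ⟨a, rfl⟩ := a
    exact ⟨c.invEmbedding a, Subtype.ext (c.embedding_comp_inv a)⟩

lemma Composition.prod_map_factorial :
    (c.blocks.map Nat.factorial).prod = ∏ i, (c.blocksFun i).factorial := by
  conv_lhs => rw [← c.ofFn_blocksFun]
  rw [List.map_ofFn, List.prod_ofFn]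
  rfl

lemma Composition.prod_map_factorial_dvd : (c.blocks.map Nat.factorial).prod ∣ n.factorial := by
  rw [c.prod_map_factorial]
  simpa [c.sum_blocksFun] using Nat.prod_factorial_dvd_factorial_sum Finset.univ c.blocksFun

lemma Composition.card_perm_index :
    Nat.card {σ : Equiv.Perm (Fin n) // c.index ∘ σ = c.index} =
      (c.blocks.map Nat.factorial).prod := by
  rw [Nat.card_eq_fintype_card, DomMulAct.stabilizer_card, c.prod_map_factorial]
  simp only [c.card_index_fiber]

/-- The word `u` with each letter preceded by the index of its block. -/
def Composition.blockWord (u : Fin n → ℤ) (i : Fin n) : Fin c.length ×ₗ ℤ :=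
  toLex (c.index i, u i)

lemma Composition.monotone_blockWord_iff (u : Fin n → ℤ) :
    Monotone (c.blockWord u) ↔ DescentsIn (properPartialSums c.blocks) u := by
  have step (i : ℕ) (h : i + 1 < n) : c.blockWord u ⟨i, by omega⟩ ≤ c.blockWord u ⟨i + 1, h⟩ ↔
      (i + 1 ∉ properPartialSums c.blocks → u ⟨i, by omega⟩ ≤ u ⟨i + 1, h⟩) := by
    rw [← c.index_lt_index_succ_iff i h, Composition.blockWord, Composition.blockWord,
      Prod.Lex.toLex_le_toLex]
    have hm : c.index ⟨i, by omega⟩ ≤ c.index ⟨i + 1, h⟩ := c.index_mono (by simp)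
    constructor
    · rintro (h1 | h1) h2
      · exact absurd h1 h2
      · exact h1.2
    · intro h1
      by_cases h2 : c.index ⟨i, by omega⟩ < c.index ⟨i + 1, h⟩
      · exact Or.inl h2
      · exact Or.inr ⟨le_antisymm hm (not_lt.1 h2), h1 h2⟩
  constructor
  · intro hmono i h
    exact (step i h).1 (hmono (by simp))
  · intro hd
    obtain _ | m := n
    · exact fun i => i.elim0
    · rw [Fin.monotone_iff_le_succ]
      exact fun i => (step i (by omega)).2 (hd i (by omega))

lemma Composition.blockWord_comp (u : Fin n → ℤ) {σ : Equiv.Perm (Fin n)}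
    (hσ : c.index ∘ σ = c.index) : c.blockWord (u ∘ σ) = c.blockWord u ∘ σ := by
  funext i
  have := congrFun hσ i
  simp only [Function.comp_apply] at this
  simp [Composition.blockWord, this]

/-- Sorting the letters of a word inside each block: a family of injective words closed under
rearrangement within blocks is the product of its block-increasing members with the Young
subgroup. -/
lemma Composition.ncard_descentsIn_mul {P : Set (Fin n → ℤ)}
    (hinj : ∀ u ∈ P, Function.Injective u)
    (hP : ∀ u ∈ P, ∀ σ : Equiv.Perm (Fin n), c.index ∘ σ = c.index → u ∘ σ ∈ P) :
    {u ∈ P | DescentsIn (properPartialSums c.blocks) u}.ncard *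
      (c.blocks.map Nat.factorial).prod = P.ncard := by
  rw [← c.card_perm_index]
  change _ * Set.ncard {σ : Equiv.Perm (Fin n) | c.index ∘ σ = c.index} = _
  rw [← Set.ncard_prod]
  have inv {σ : Equiv.Perm (Fin n)} (hσ : c.index ∘ σ = c.index) :
      c.index ∘ (σ⁻¹ : Equiv.Perm (Fin n)) = c.index := by
    funext i
    have := congrFun hσ (σ⁻¹ i)
    simpa using this.symm
  refine Set.ncard_congr (fun p _ => p.1 ∘ p.2) ?_ ?_ ?_
  · rintro ⟨u, σ⟩ ⟨⟨hu, -⟩, hσ⟩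
    exact hP u hu σ hσ
  · rintro ⟨u, σ⟩ ⟨v, τ⟩ ⟨⟨hu, hu'⟩, hσ⟩ ⟨⟨hv, hv'⟩, hτ⟩ h
    simp only [Set.mem_ofPred_eq] at hu hu' hv hv' hσ hτ h
    rw [← c.monotone_blockWord_iff] at hu' hv'
    have key : c.blockWord u ∘ σ = c.blockWord v ∘ τ := by
      rw [← c.blockWord_comp u hσ, ← c.blockWord_comp v hτ, h]
    have key2 : c.blockWord u = c.blockWord v ∘ (τ * σ⁻¹ : Equiv.Perm (Fin n)) := by
      funext i
      have := congrFun key (σ⁻¹ i)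
      simpa using this
    have key3 : c.blockWord u = c.blockWord v := by
      rw [key2]
      exact Tuple.unique_monotone (f := c.blockWord v) (τ := 1) (by rw [← key2]; exact hu') hv'
    have huv : u = v := by
      funext i
      have := congrFun key3 i
      simp only [Composition.blockWord, toLex_inj, Prod.mk.injEq] at this
      exact this.2
    subst huv
    rw [Prod.mk.injEq]
    exact ⟨rfl, Equiv.ext fun i => hinj u hu (congrFun h i)⟩
  · intro u hu
    set σ := Tuple.sort (c.blockWord u) with hσdef
    have hmono : Monotone (c.blockWord u ∘ σ) := Tuple.monotone_sort _
    have hσ : c.index ∘ σ = c.index := by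
      refine Tuple.unique_monotone (f := c.index) (σ := σ) (τ := 1) ?_ c.index_mono
      exact fun i j hij => Prod.Lex.monotone_fst _ _ (hmono hij)
    refine ⟨(u ∘ σ, σ⁻¹), ⟨⟨hP u hu σ hσ, ?_⟩, inv hσ⟩, ?_⟩
    · rw [← c.monotone_blockWord_iff, c.blockWord_comp u hσ]
      exact hmono
    · funext i
      simp

end Composition

section SignedWords

variable {n : ℕ}

/-- Words `u(1) … u(n)` of signed permutations of `[n]`. -/
def signedWords (n : ℕ) : Set (Fin n → ℤ) :=
  {u | Function.Injective (fun i => |u i|) ∧ ∀ i, u i ≠ 0 ∧ |u i| ≤ n}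

/-- Words of signed permutations whose first `k` letters are positive. -/
def posWords (n k : ℕ) : Set (Fin n → ℤ) :=
  {u ∈ signedWords n | ∀ i : Fin n, (i : ℕ) < k → 0 < u i}

lemma signedWords_injective {u : Fin n → ℤ} (hu : u ∈ signedWords n) : Function.Injective u :=
  fun _ _ h => hu.1 (congrArg abs h)

lemma exists_perm_of_mem_signedWords {u : Fin n → ℤ} (hu : u ∈ signedWords n) :
    ∃ σ : Equiv.Perm (Fin n), ∀ i, |u i| = (σ i : ℤ) + 1 := by
  have hb (i : Fin n) : (u i).natAbs - 1 < n := by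
    have := hu.2 i
    rw [Int.abs_eq_natAbs] at this
    omega
  let f : Fin n → Fin n := fun i => ⟨(u i).natAbs - 1, hb i⟩
  have hf : Function.Injective f := by
    intro i j hij
    have h1 := congrArg Fin.val hij
    have hi := hu.2 i
    have hj := hu.2 j
    apply hu.1
    simp only [f, Int.abs_eq_natAbs] at h1 hi hj ⊢
    omega
  refine ⟨Equiv.ofBijective f (Finite.injective_iff_bijective.1 hf), fun i => ?_⟩
  have hi := hu.2 i
  simp only [Equiv.ofBijective_apply, f, Int.abs_eq_natAbs] at hi ⊢
  omega

lemma comp_perm_mem_signedWords {u : Fin n → ℤ} (hu : u ∈ signedWords n)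
    (σ : Equiv.Perm (Fin n)) : u ∘ σ ∈ signedWords n :=
  ⟨fun _ _ h => σ.injective (hu.1 h), fun i => hu.2 (σ i)⟩

lemma posWords_zero : posWords n 0 = signedWords n := by
  ext u
  simp [posWords]

/-- Sign patterns whose first `k` entries are positive. -/
def signPatterns (n k : ℕ) : Finset (Fin n → ℤ) :=
  Fintype.piFinset fun i : Fin n => if (i : ℕ) < k then {1} else {1, -1}

lemma card_signPatterns {k : ℕ} (hk : k ≤ n) : (signPatterns n k).card = 2 ^ (n - k) := by
  rw [signPatterns, Fintype.card_piFinset]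
  have h (i : Fin n) : (if (i : ℕ) < k then ({1} : Finset ℤ) else {1, -1}).card =
      if (i : ℕ) < k then 1 else 2 := by
    split_ifs <;> rfl
  simp only [h]
  rw [Fin.prod_univ_eq_prod_range (fun i => if i < k then 1 else 2) n,
    ← Finset.prod_range_mul_prod_Ico _ hk, Finset.prod_eq_one, one_mul,
    Finset.prod_congr rfl (g := fun _ => 2)]
  · simp
  · intro i hi
    rw [Finset.mem_Ico] at hi
    rw [if_neg (by omega)]
  · intro i hi
    rw [if_pos (Finset.mem_range.1 hi)]

lemma abs_eq_one_of_mem_signPatterns {k : ℕ} {ε : Fin n → ℤ} (hε : ε ∈ signPatterns n k)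
    (i : Fin n) : |ε i| = 1 := by
  have := Fintype.mem_piFinset.1 hε i
  split_ifs at this
  · simp [Finset.mem_singleton.1 this]
  · rcases (by simpa using this : ε i = 1 ∨ ε i = -1) with h | h <;> simp [h]

lemma ncard_posWords {k : ℕ} (hk : k ≤ n) :
    (posWords n k).ncard = 2 ^ (n - k) * n.factorial := by
  let A : Finset ((Fin n → ℤ) × Equiv.Perm (Fin n)) := signPatterns n k ×ˢ Finset.univ
  have hA : (A : Set ((Fin n → ℤ) × Equiv.Perm (Fin n))).ncard = 2 ^ (n - k) * n.factorial := by
    rw [Set.ncard_coe_finset, Finset.card_product, card_signPatterns hk, Finset.card_univ,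
      Fintype.card_perm, Fintype.card_fin]
  rw [← hA]
  symm
  have habs {ε : Fin n → ℤ} (hε : ε ∈ signPatterns n k) (σ : Equiv.Perm (Fin n)) (i : Fin n) :
      |ε i * ((σ i : ℤ) + 1)| = (σ i : ℤ) + 1 := by
    rw [abs_mul, abs_eq_one_of_mem_signPatterns hε, one_mul, abs_of_nonneg (by positivity)]
  refine Set.ncard_congr (fun p _ i => p.1 i * ((p.2 i : ℤ) + 1)) ?_ ?_ ?_
  · rintro ⟨ε, σ⟩ hp
    have hε : ε ∈ signPatterns n k := by simpa [A] using hp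
    refine ⟨⟨fun i j hij => ?_, fun i => ?_⟩, fun i hi => ?_⟩
    · simp only [habs hε] at hij
      exact σ.injective (Fin.ext (by omega))
    · have h := habs hε σ i
      refine ⟨fun h0 => ?_, ?_⟩
      · simp only at h0
        rw [h0, abs_zero] at h
        omega
      · simp only [h]
        omega
    · have := Fintype.mem_piFinset.1 hε i
      rw [if_pos hi, Finset.mem_singleton] at this
      simp only [this]
      positivity
  · rintro ⟨ε, σ⟩ ⟨δ, τ⟩ hp hq h
    have hε : ε ∈ signPatterns n k := by simpa [A] using hp
    have hδ : δ ∈ signPatterns n k := by simpa [A] using hq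
    have hστ : σ = τ := by
      refine Equiv.ext fun i => Fin.ext ?_
      have := congrArg abs (congrFun h i)
      simp only [habs hε, habs hδ] at this
      omega
    subst hστ
    rw [Prod.mk.injEq]
    refine ⟨funext fun i => ?_, rfl⟩
    exact mul_right_cancel₀ (by positivity) (congrFun h i)
  · rintro u ⟨hu, hpos⟩
    obtain ⟨σ, hσ⟩ := exists_perm_of_mem_signedWords hu
    refine ⟨(fun i => (u i).sign, σ), ?_, ?_⟩
    · simp only [A, Finset.coe_product, Finset.coe_univ, Set.mem_prod, Set.mem_univ, and_true,
        Finset.mem_coe, signPatterns, Fintype.mem_piFinset]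
      intro i
      split_ifs with hi
      · simp [Int.sign_eq_one_of_pos (hpos i hi)]
      · rcases lt_or_gt_of_ne (hu.2 i).1 with h | h
        · simp [Int.sign_eq_neg_one_of_neg h]
        · simp [Int.sign_eq_one_of_pos h]
    · funext i
      simp only [← hσ]
      exact Int.sign_mul_abs (u i)

lemma finite_signedWords : (signedWords n).Finite := by
  apply Set.finite_of_ncard_pos
  rw [← posWords_zero, ncard_posWords (Nat.zero_le n)]
  positivity

/-- Words of signed permutations with an even number of negative letters. -/
def evenWords (n : ℕ) : Set (Fin n → ℤ) := {u ∈ signedWords n | 0 < ∏ i, u i}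

/-- Words of signed permutations with an odd number of negative letters. -/
def oddWords (n : ℕ) : Set (Fin n → ℤ) := {u ∈ signedWords n | ∏ i, u i < 0}

/-- Change the sign of the letter at position `i`. -/
def flipAt (i : Fin n) (u : Fin n → ℤ) : Fin n → ℤ := Function.update u i (-u i)

@[simp] lemma flipAt_self (i : Fin n) (u : Fin n → ℤ) : flipAt i u i = -u i := by simp [flipAt]

@[simp] lemma flipAt_of_ne {i j : Fin n} (h : j ≠ i) (u : Fin n → ℤ) : flipAt i u j = u j := by
  simp [flipAt, h]

lemma flipAt_flipAt (i : Fin n) (u : Fin n → ℤ) : flipAt i (flipAt i u) = u := by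
  simp [flipAt]

lemma abs_flipAt (i j : Fin n) (u : Fin n → ℤ) : |flipAt i u j| = |u j| := by
  by_cases h : j = i
  · subst h
    simp
  · simp [h]

lemma prod_flipAt (i : Fin n) (u : Fin n → ℤ) : ∏ j, flipAt i u j = -∏ j, u j := by
  rw [flipAt, Finset.prod_update_of_mem (Finset.mem_univ i), neg_mul, ← Finset.erase_eq,
    Finset.mul_prod_erase _ _ (Finset.mem_univ i)]

lemma flipAt_mem_signedWords (i : Fin n) {u : Fin n → ℤ} (hu : u ∈ signedWords n) :
    flipAt i u ∈ signedWords n := by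
  refine ⟨by simpa only [abs_flipAt] using hu.1, fun j => ?_⟩
  rw [← abs_pos, abs_flipAt, abs_pos]
  exact hu.2 j

lemma flipAt_mem_oddWords (i : Fin n) {u : Fin n → ℤ} (hu : u ∈ evenWords n) :
    flipAt i u ∈ oddWords n :=
  ⟨flipAt_mem_signedWords i hu.1, by rw [prod_flipAt, neg_lt_zero]; exact hu.2⟩

lemma flipAt_mem_evenWords (i : Fin n) {u : Fin n → ℤ} (hu : u ∈ oddWords n) :
    flipAt i u ∈ evenWords n :=
  ⟨flipAt_mem_signedWords i hu.1, by rw [prod_flipAt, neg_pos]; exact hu.2⟩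

lemma ncard_evenWords_eq_ncard_oddWords (hn : 0 < n) :
    (evenWords n).ncard = (oddWords n).ncard := by
  let z : Fin n := ⟨0, hn⟩
  refine Set.ncard_congr (fun u _ => flipAt z u) (fun u hu => flipAt_mem_oddWords z hu) ?_ ?_
  · intro u v _ _ h
    rw [← flipAt_flipAt z u, h, flipAt_flipAt]
  · exact fun u hu => ⟨flipAt z u, flipAt_mem_evenWords z hu, flipAt_flipAt z u⟩

lemma ncard_evenWords (hn : 0 < n) : (evenWords n).ncard = 2 ^ (n - 1) * n.factorial := by
  have hunion : evenWords n ∪ oddWords n = signedWords n := by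
    ext u
    simp only [evenWords, oddWords, Set.mem_union, Set.mem_ofPred_eq, ← and_or_left,
      and_iff_left_iff_imp]
    intro hu
    exact (lt_or_gt_of_ne (Finset.prod_ne_zero_iff.2 fun i _ => (hu.2 i).1)).symm
  have hdisj : Disjoint (evenWords n) (oddWords n) :=
    Set.disjoint_left.2 fun u hu hv => lt_asymm hu.2 hv.2
  have h := Set.ncard_union_eq hdisj (finite_signedWords.subset fun u hu => hu.1)
    (finite_signedWords.subset fun u hu => hu.1)
  rw [hunion, ← ncard_evenWords_eq_ncard_oddWords hn, ← posWords_zero,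
    ncard_posWords (Nat.zero_le n), Nat.sub_zero] at h
  obtain ⟨m, rfl⟩ : ∃ m, n = m + 1 := ⟨n - 1, by omega⟩
  rw [pow_succ] at h
  rw [Nat.add_sub_cancel]
  linarith

lemma ncard_oddWords (hn : 0 < n) : (oddWords n).ncard = 2 ^ (n - 1) * n.factorial := by
  rw [← ncard_evenWords_eq_ncard_oddWords hn, ncard_evenWords hn]

lemma comp_perm_mem_evenWords {u : Fin n → ℤ} (hu : u ∈ evenWords n)
    (σ : Equiv.Perm (Fin n)) : u ∘ σ ∈ evenWords n :=
  ⟨comp_perm_mem_signedWords hu.1 σ, by simpa using (Equiv.prod_comp σ u).symm ▸ hu.2⟩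

lemma comp_perm_mem_oddWords {u : Fin n → ℤ} (hu : u ∈ oddWords n)
    (σ : Equiv.Perm (Fin n)) : u ∘ σ ∈ oddWords n :=
  ⟨comp_perm_mem_signedWords hu.1 σ, by simpa using (Equiv.prod_comp σ u).symm ▸ hu.2⟩

end SignedWords

section Restriction

variable {n : ℕ}

/-- The word `w(1) … w(n)`. -/
def wordOf (n : ℕ) (w : ℤ → ℤ) (i : Fin n) : ℤ := w ((i : ℤ) + 1)

lemma SignedPerms.map_zero {w : ℤ → ℤ} (hw : w ∈ SignedPerms n) : w 0 = 0 := by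
  have := hw.2.1 0
  rw [neg_zero] at this
  omega

lemma wordOf_mem_signedWords {w : ℤ → ℤ} (hw : w ∈ SignedPerms n) :
    wordOf n w ∈ signedWords n := by
  have h0 := SignedPerms.map_zero hw
  obtain ⟨hbij, hneg, hfix⟩ := hw
  refine ⟨fun i j hij => ?_, fun i => ⟨fun hi => ?_, ?_⟩⟩
  · simp only [wordOf] at hij
    rcases abs_eq_abs.1 hij with h | h
    · have := hbij.1 h
      exact Fin.ext (by omega)
    · rw [← hneg] at h
      have := hbij.1 h
      omega
  · have := hbij.1 (hi.trans h0.symm)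
    omega
  · by_contra! h
    have h2 := hbij.1 (hfix _ h)
    rw [wordOf, h2, abs_of_nonneg (by positivity)] at h
    omega

lemma wordOf_injOn : Set.InjOn (wordOf n) (SignedPerms n) := by
  intro w hw v hv h
  have hpos (j : ℤ) (hj : 0 < j) : w j = v j := by
    by_cases hjn : j ≤ n
    · have := congrFun h ⟨(j - 1).toNat, by omega⟩
      simp only [wordOf] at this
      rwa [show (((j - 1).toNat : ℕ) : ℤ) + 1 = j by omega] at this
    · have : (n : ℤ) < |j| := by rw [abs_of_pos hj]; omega
      rw [hw.2.2 j this, hv.2.2 j this]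
  funext j
  rcases lt_trichotomy j 0 with hj | rfl | hj
  · have := hpos (-j) (by omega)
    rw [hw.2.1, hv.2.1] at this
    omega
  · rw [SignedPerms.map_zero hw, SignedPerms.map_zero hv]
  · exact hpos j hj

/-- The odd extension of a word to a function on `ℤ`, the identity outside `[-n, n]`. -/
def oddExtension (u : Fin n → ℤ) (j : ℤ) : ℤ :=
  if h : j ≠ 0 ∧ j.natAbs ≤ n then j.sign * u ⟨j.natAbs - 1, by omega⟩ else j

lemma oddExtension_neg (u : Fin n → ℤ) (j : ℤ) : oddExtension u (-j) = -oddExtension u j := by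
  unfold oddExtension
  by_cases h : j ≠ 0 ∧ j.natAbs ≤ n
  · have h' : -j ≠ 0 ∧ (-j).natAbs ≤ n := by simpa using h
    rw [dif_pos h, dif_pos h', Int.sign_neg, neg_mul]
    congr 3
    simp
  · have h' : ¬(-j ≠ 0 ∧ (-j).natAbs ≤ n) := by simpa using h
    rw [dif_neg h, dif_neg h']

lemma wordOf_oddExtension (u : Fin n → ℤ) : wordOf n (oddExtension u) = u := by
  funext i
  have h : (i : ℤ) + 1 ≠ 0 ∧ ((i : ℤ) + 1).natAbs ≤ n := by omega
  rw [wordOf, oddExtension, dif_pos h, Int.sign_eq_one_of_pos (by omega), one_mul]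
  congr 1

lemma abs_oddExtension {u : Fin n → ℤ} {j : ℤ} (hj : j ≠ 0) (hjn : j.natAbs ≤ n) :
    |oddExtension u j| = |u ⟨j.natAbs - 1, by omega⟩| := by
  rw [oddExtension, dif_pos ⟨hj, hjn⟩, abs_mul, Int.abs_sign_of_ne_zero hj, one_mul]

lemma oddExtension_mem_signedPerms {u : Fin n → ℤ} (hu : u ∈ signedWords n) :
    oddExtension u ∈ SignedPerms n := by
  have hout (j : ℤ) (hj : ¬(j ≠ 0 ∧ j.natAbs ≤ n)) : oddExtension u j = j := dif_neg hj
  have hin (j : ℤ) (hj : j ≠ 0 ∧ j.natAbs ≤ n) :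
      oddExtension u j ≠ 0 ∧ (oddExtension u j).natAbs ≤ n := by
    have h := abs_oddExtension (u := u) hj.1 hj.2
    have h2 := hu.2 ⟨j.natAbs - 1, by omega⟩
    rw [← abs_pos, ← h, abs_pos, Int.abs_eq_natAbs] at h2
    omega
  refine ⟨⟨fun a b hab => ?_, fun y => ?_⟩, oddExtension_neg u, fun j hj => hout j (by
    rw [Int.abs_eq_natAbs] at hj; omega)⟩
  · by_cases ha : a ≠ 0 ∧ a.natAbs ≤ n
    · by_cases hb : b ≠ 0 ∧ b.natAbs ≤ n
      · have h := congrArg abs hab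
        rw [abs_oddExtension ha.1 ha.2, abs_oddExtension hb.1 hb.2] at h
        have h2 := congrArg Fin.val (hu.1 h)
        simp only at h2
        rcases Int.natAbs_eq_natAbs_iff.1 (by omega : a.natAbs = b.natAbs) with h3 | h3
        · exact h3
        · rw [h3, oddExtension_neg] at hab
          have := (hin b hb).1
          omega
      · have := hin a ha
        rw [hab, hout b hb] at this
        exact absurd this hb
    · by_cases hb : b ≠ 0 ∧ b.natAbs ≤ n
      · have := hin b hb
        rw [← hab, hout a ha] at this
        exact absurd this ha
      · rwa [hout a ha, hout b hb] at hab
  · by_cases hy : y ≠ 0 ∧ y.natAbs ≤ n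
    · obtain ⟨σ, hσ⟩ := exists_perm_of_mem_signedWords hu
      have h := hσ (σ.symm ⟨y.natAbs - 1, by omega⟩)
      rw [Equiv.apply_symm_apply] at h
      set i := σ.symm ⟨y.natAbs - 1, by omega⟩
      have hi : oddExtension u ((i : ℤ) + 1) = u i := congrFun (wordOf_oddExtension u) i
      rcases abs_eq_abs.1 (show |u i| = |y| by
        rw [h, Int.abs_eq_natAbs]; simp only; omega) with h2 | h2
      · exact ⟨_, hi.trans h2⟩
      · exact ⟨-((i : ℤ) + 1), by rw [oddExtension_neg, hi, h2, neg_neg]⟩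
    · exact ⟨y, hout y hy⟩

lemma prod_pos_iff_even_card_neg {ι : Type*} (s : Finset ι) (f : ι → ℤ) (hf : ∀ i ∈ s, f i ≠ 0) :
    0 < ∏ i ∈ s, f i ↔ Even (s.filter fun i => f i < 0).card := by
  classical
  induction s using Finset.induction_on with
  | empty => simp
  | insert a s ha ih =>
    have ih := ih fun i hi => hf i (Finset.mem_insert_of_mem hi)
    have hne : ∏ i ∈ s, f i ≠ 0 :=
      Finset.prod_ne_zero_iff.2 fun i hi => hf i (Finset.mem_insert_of_mem hi)
    rw [Finset.prod_insert ha, Finset.filter_insert]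
    rcases lt_or_gt_of_ne (hf a (Finset.mem_insert_self a s)) with h | h
    · rw [if_pos h, Finset.card_insert_of_notMem (by simp [ha]), Nat.even_add_one, ← ih,
        ← neg_mul_neg, mul_pos_iff_of_pos_left (neg_pos.2 h), neg_pos, not_lt, le_iff_lt_or_eq, or_iff_left hne]
    · rw [if_neg h.not_gt, ← ih, mul_pos_iff_of_pos_left h]

lemma mem_evenSignedPerms_iff {w : ℤ → ℤ} (hw : w ∈ SignedPerms n) :
    w ∈ EvenSignedPerms n ↔ wordOf n w ∈ evenWords n := by
  have hword := wordOf_mem_signedWords hw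
  have hprod : ∏ i ∈ Finset.Icc (1 : ℤ) n, w i = ∏ i, wordOf n w i := by
    symm
    refine Finset.prod_bij (fun i _ => (i : ℤ) + 1) ?_ ?_ ?_ ?_
    · intro i _
      simp only [Finset.mem_Icc]
      omega
    · exact fun i _ j _ h => Fin.ext (by omega)
    · intro j hj
      rw [Finset.mem_Icc] at hj
      exact ⟨⟨(j - 1).toNat, by omega⟩, Finset.mem_univ _, by simp only; omega⟩
    · exact fun i _ => rfl
  have hne : ∀ i ∈ Finset.Icc (1 : ℤ) n, w i ≠ 0 := by
    intro i hi h
    rw [Finset.mem_Icc] at hi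
    have := hw.1.1 (h.trans (SignedPerms.map_zero hw).symm)
    omega
  simp only [EvenSignedPerms, evenWords, Set.mem_ofPred_eq, hw, hword, true_and]
  rw [← prod_pos_iff_even_card_neg _ _ hne, hprod]

/-- The type D descents of a word of length at least two lie in `S`. -/
def DescentsDIn (hn : 1 < n) (S : Set ℕ) (u : Fin n → ℤ) : Prop :=
  (0 ∉ S → 0 ≤ u ⟨0, by omega⟩ + u ⟨1, hn⟩) ∧ DescentsIn S u

lemma desD_subset_iff (hn : 1 < n) (S : Set ℕ) (w : ℤ → ℤ) :
    DesD n w ⊆ S ↔ DescentsDIn hn S (wordOf n w) := by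
  constructor
  · intro h
    refine ⟨fun h0 => ?_, fun i hi hS => ?_⟩
    · by_contra! hlt
      refine h0 (h ⟨by omega, ?_⟩)
      simp only [wordOf] at hlt
      norm_num at hlt ⊢
      omega
    · by_contra! hlt
      refine hS (h ⟨hi, ?_⟩)
      simpa [wordOf] using hlt
  · rintro ⟨h0, h1⟩ i ⟨hi, hlt⟩
    by_contra hS
    obtain _ | i := i
    · have := h0 hS
      simp only [wordOf] at this
      norm_num at hlt this
      omega
    · have := h1 i hi hS
      simp only [wordOf] at this
      simp only [Nat.add_eq_zero_iff, one_ne_zero, and_false, if_false] at hlt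
      push_cast at hlt this
      omega

lemma ncard_evenSignedPerms_desD_subset (hn : 1 < n) (S : Set ℕ) :
    {w ∈ EvenSignedPerms n | DesD n w ⊆ S}.ncard =
      {u ∈ evenWords n | DescentsDIn hn S u}.ncard := by
  refine Set.ncard_congr (fun w _ => wordOf n w) ?_ ?_ ?_
  · exact fun w hw => ⟨(mem_evenSignedPerms_iff hw.1.1).1 hw.1, (desD_subset_iff hn S w).1 hw.2⟩
  · exact fun w v hw hv h => wordOf_injOn hw.1.1 hv.1.1 h
  · intro u hu
    have hmem := oddExtension_mem_signedPerms hu.1.1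
    refine ⟨oddExtension u, ⟨(mem_evenSignedPerms_iff hmem).2 ?_, (desD_subset_iff hn S _).2 ?_⟩,
      wordOf_oddExtension u⟩
    · rw [wordOf_oddExtension]
      exact hu.1
    · rw [wordOf_oddExtension]
      exact hu.2

end Restriction

section Main

variable {n : ℕ}

lemma eq_mul_div_of_mul_eq {N a b m : ℕ} (hd : m ∣ b) (hm : 0 < m) (h : N * m = a * b) :
    N = a * (b / m) := by
  rw [← Nat.mul_div_assoc _ hd]
  exact (Nat.div_eq_of_eq_mul_left hm h.symm).symm

lemma Composition.prod_map_factorial_pos (c : Composition n) :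
    0 < (c.blocks.map Nat.factorial).prod :=
  Nat.pos_of_dvd_of_pos c.prod_map_factorial_dvd n.factorial_pos

lemma Composition.ncard_evenWords_descentsIn (hn : 0 < n) (c : Composition n) :
    {u ∈ evenWords n | DescentsIn (properPartialSums c.blocks) u}.ncard =
      2 ^ (n - 1) * (n.factorial / (c.blocks.map Nat.factorial).prod) := by
  apply eq_mul_div_of_mul_eq c.prod_map_factorial_dvd c.prod_map_factorial_pos
  rw [c.ncard_descentsIn_mul (fun u hu => signedWords_injective hu.1)
    (fun u hu σ _ => comp_perm_mem_evenWords hu σ), ncard_evenWords hn]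

lemma Composition.ncard_oddWords_descentsIn (hn : 0 < n) (c : Composition n) :
    {u ∈ oddWords n | DescentsIn (properPartialSums c.blocks) u}.ncard =
      2 ^ (n - 1) * (n.factorial / (c.blocks.map Nat.factorial).prod) := by
  apply eq_mul_div_of_mul_eq c.prod_map_factorial_dvd c.prod_map_factorial_pos
  rw [c.ncard_descentsIn_mul (fun u hu => signedWords_injective hu.1)
    (fun u hu σ _ => comp_perm_mem_oddWords hu σ), ncard_oddWords hn]

lemma le_of_mem_properPartialSums_cons {k m : ℕ} {L : List ℕ}
    (hm : m ∈ properPartialSums (k :: L)) : k ≤ m := by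
  obtain ⟨_ | i, hi, -, rfl⟩ := hm
  · omega
  · simp

lemma mem_properPartialSums_cons {k m : ℕ} {L : List ℕ} :
    m ∈ properPartialSums (k :: L) ↔ L ≠ [] ∧ (m = k ∨ ∃ s ∈ properPartialSums L, m = k + s) := by
  constructor
  · rintro ⟨i, hi, hil, rfl⟩
    obtain ⟨i, rfl⟩ : ∃ j, i = j + 1 := ⟨i - 1, by omega⟩
    simp only [List.length_cons, Nat.add_lt_add_iff_right] at hil
    refine ⟨List.ne_nil_of_length_pos (by omega), ?_⟩
    rw [List.take_succ_cons, List.sum_cons]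
    obtain _ | i := i
    · simp
    · exact Or.inr ⟨_, ⟨i + 1, by omega, hil, rfl⟩, rfl⟩
  · rintro ⟨hL, rfl | ⟨s, ⟨i, hi, hil, rfl⟩, rfl⟩⟩
    · exact ⟨1, by omega, by simpa using List.length_pos_iff.2 hL, by simp⟩
    · exact ⟨i + 1, by omega, by simpa using hil, by simp⟩

lemma Composition.index_eq_zero_iff_lt {k : ℕ} {t : List ℕ} (c : Composition n)
    (hc : c.blocks = k :: t) (i : Fin n) : (c.index i : ℕ) = 0 ↔ (i : ℕ) < k := by
  have hsize : c.sizeUpTo 1 = k := by simp [Composition.sizeUpTo, hc]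
  constructor
  · intro h
    have := c.lt_sizeUpTo_index_succ i
    rwa [Fin.val_succ, h, zero_add, hsize] at this
  · intro h
    by_contra h0
    have h1 := c.monotone_sizeUpTo (show 1 ≤ (c.index i : ℕ) by omega)
    have h2 := c.sizeUpTo_index_le i
    omega

lemma Composition.ncard_posWords_descentsIn {k : ℕ} {t : List ℕ} (c : Composition n)
    (hc : c.blocks = k :: t) :
    {u ∈ posWords n k | DescentsIn (properPartialSums c.blocks) u}.ncard =
      2 ^ (n - k) * (n.factorial / (c.blocks.map Nat.factorial).prod) := by
  apply eq_mul_div_of_mul_eq c.prod_map_factorial_dvd c.prod_map_factorial_pos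
  have hk : k ≤ n := c.blocks_le (by simp [hc])
  rw [c.ncard_descentsIn_mul (fun u hu => signedWords_injective hu.1) ?_, ncard_posWords hk]
  refine fun u hu σ hσ => ⟨comp_perm_mem_signedWords hu.1 σ, fun i hi => hu.2 _ ?_⟩
  rw [← c.index_eq_zero_iff_lt hc] at hi ⊢
  rw [← hi]
  exact congrArg Fin.val (congrFun hσ i)

/-- Changing the sign of the first letter exchanges the type D descent at position `0` with the
ordinary descent at position `1`. -/
lemma ncard_evenWords_descentsDIn_of_one_mem (hn : 1 < n) {S T : Set ℕ} (hS0 : 0 ∉ S)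
    (hS1 : 1 ∈ S) (hT1 : 1 ∉ T) (hST : ∀ m, 2 ≤ m → (m ∈ S ↔ m ∈ T)) :
    {u ∈ evenWords n | DescentsDIn hn S u}.ncard = {u ∈ oddWords n | DescentsIn T u}.ncard := by
  let z : Fin n := ⟨0, by omega⟩
  have hz (i : ℕ) (h : i + 1 < n) (u : Fin n → ℤ) : flipAt z u ⟨i + 1, h⟩ = u ⟨i + 1, h⟩ :=
    flipAt_of_ne (by simp [z, Fin.ext_iff]) u
  have hz0 (u : Fin n → ℤ) : flipAt z u ⟨0, by omega⟩ = -u ⟨0, by omega⟩ := flipAt_self z u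
  have key (u : Fin n → ℤ) : DescentsDIn hn S u ↔ DescentsIn T (flipAt z u) := by
    constructor
    · rintro ⟨h0, h1⟩ i hi hT
      obtain _ | i := i
      · have := h0 hS0
        rw [hz, hz0]
        simp only [zero_add]
        omega
      · rw [hz, hz]
        exact h1 (i + 1) hi (by rwa [hST _ (by omega)])
    · refine fun h => ⟨fun _ => ?_, fun i hi hS => ?_⟩
      · have := h 0 hn hT1
        rw [hz, hz0] at this
        simp only [zero_add] at this
        omega
      · obtain _ | i := i
        · exact absurd hS1 hS
        · have := h (i + 1) hi (by rwa [← hST _ (by omega)])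
          rwa [hz, hz] at this
  refine Set.ncard_congr (fun u _ => flipAt z u) ?_ ?_ ?_
  · exact fun u hu => ⟨flipAt_mem_oddWords z hu.1, (key u).1 hu.2⟩
  · intro u v _ _ h
    rw [← flipAt_flipAt z u, h, flipAt_flipAt]
  · intro u hu
    refine ⟨flipAt z u, ⟨flipAt_mem_evenWords z hu.1, (key _).2 ?_⟩, flipAt_flipAt z u⟩
    rw [flipAt_flipAt]
    exact hu.2

/-- If the first `k ≥ 2` letters carry no type D descent, the sign of the first letter is
determined by parity and can be forgotten. -/
lemma ncard_evenWords_descentsDIn_of_lt (hn : 1 < n) {S : Set ℕ} {k : ℕ} (hk : 1 < k)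
    (hS : ∀ m ∈ S, k ≤ m) :
    {u ∈ evenWords n | DescentsDIn hn S u}.ncard = {u ∈ posWords n k | DescentsIn S u}.ncard := by
  let z : Fin n := ⟨0, by omega⟩
  have hz (i : ℕ) (h : i + 1 < n) (u : Fin n → ℤ) : flipAt z u ⟨i + 1, h⟩ = u ⟨i + 1, h⟩ :=
    flipAt_of_ne (by simp [z, Fin.ext_iff]) u
  have hz0 (u : Fin n → ℤ) : flipAt z u ⟨0, by omega⟩ = -u ⟨0, by omega⟩ := flipAt_self z u
  have hS0 : 0 ∉ S := fun h => by have := hS 0 h; omega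
  have hS1 : 1 ∉ S := fun h => by have := hS 1 h; omega
  have hflip (u : Fin n → ℤ) (hu : DescentsDIn hn S u) : DescentsDIn hn S (flipAt z u) := by
    have h0 := hu.1 hS0
    have h1 := hu.2 0 hn hS1
    simp only [zero_add] at h1
    refine ⟨fun _ => ?_, fun i hi hiS => ?_⟩
    · have := hz 0 hn u
      simp only [zero_add] at this
      rw [this, hz0]
      omega
    · obtain _ | i := i
      · rw [hz, hz0]
        simp only [zero_add]
        omega
      · rw [hz, hz]
        exact hu.2 (i + 1) hi hiS
  have hpos (u : Fin n → ℤ) (hmem : u ∈ signedWords n) (hu : DescentsDIn hn S u) (h0 : 0 < u z) :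
      u ∈ posWords n k := by
    refine ⟨hmem, ?_⟩
    rintro ⟨i, hin⟩ hi
    simp only at hi
    induction i with
    | zero => exact h0
    | succ i ih =>
      refine (ih (by omega) (by omega)).trans_le (hu.2 i hin fun h => ?_)
      have := hS _ h
      omega
  have hD (u : Fin n → ℤ) (hu : u ∈ posWords n k) (hd : DescentsIn S u) : DescentsDIn hn S u := by
    refine ⟨fun _ => ?_, hd⟩
    have h0 := hu.2 ⟨0, by omega⟩ (by simp only; omega)
    have h1 := hu.2 ⟨1, hn⟩ hk
    omega
  refine Set.ncard_congr (fun u _ => if 0 < u z then u else flipAt z u) ?_ ?_ ?_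
  · rintro u ⟨hu, hd⟩
    split_ifs with h
    · exact ⟨hpos u hu.1 hd h, hd.2⟩
    · refine ⟨hpos _ (flipAt_mem_signedWords z hu.1) (hflip u hd) ?_, (hflip u hd).2⟩
      have := (hu.1.2 z).1
      rw [flipAt_self]
      omega
  · rintro u v ⟨hu, -⟩ ⟨hv, -⟩ h
    have hne {a b : Fin n → ℤ} (ha : a ∈ evenWords n) (hb : b ∈ evenWords n) :
        a ≠ flipAt z b := fun hab => by
      have h1 := (flipAt_mem_oddWords z hb).2
      rw [← hab] at h1
      exact lt_asymm h1 ha.2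
    split_ifs at h
    · exact h
    · exact absurd h (hne hu hv)
    · exact absurd h.symm (hne hv hu)
    · rw [← flipAt_flipAt z u, h, flipAt_flipAt]
  · rintro u ⟨hu, hd⟩
    have hu0 : 0 < u z := hu.2 z (by simp only [z]; omega)
    rcases lt_or_gt_of_ne (Finset.prod_ne_zero_iff.2 fun i _ => (hu.1.2 i).1 : ∏ i, u i ≠ 0)
      with h | h
    · refine ⟨flipAt z u, ⟨flipAt_mem_evenWords z ⟨hu.1, h⟩, hflip u (hD u hu hd)⟩, ?_⟩
      rw [if_neg (by rw [flipAt_self]; omega), flipAt_flipAt]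
    · exact ⟨u, ⟨⟨hu.1, h⟩, hD u hu hd⟩, if_pos hu0⟩

end Main

/-- The number of even signed permutations in Dₙ with descent set contained in D(β):
it is 2^{n-1}·n!/(β₁!⋯β_ℓ!) if β₁ = 0; 2^{n-1}·n!/((1+β₂)!β₃!⋯β_ℓ!) if β₁ = 1;
and 2^{n-β₁}·n!/(β₁!⋯β_ℓ!) if β₁ > 1. -/
theorem card_desD_subset {n : ℕ} (hn : 4 ≤ n) (β : PseudoComposition n) :
    (β.parts.headI = 0 →
      Set.ncard {w ∈ EvenSignedPerms n | DesD n w ⊆ DsetB β} =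
        2 ^ (n - 1) * (n.factorial / (β.parts.map Nat.factorial).prod)) ∧
    (β.parts.headI = 1 →
      Set.ncard {w ∈ EvenSignedPerms n | DesD n w ⊆ DsetB β} =
        2 ^ (n - 1) *
          (n.factorial /
            (((1 + β.parts.tail.headI) :: β.parts.tail.tail).map Nat.factorial).prod)) ∧
    (1 < β.parts.headI →
      Set.ncard {w ∈ EvenSignedPerms n | DesD n w ⊆ DsetB β} =
        2 ^ (n - β.parts.headI) * (n.factorial / (β.parts.map Nat.factorial).prod)) := by
  have hn1 : 1 < n := by omega
  change (_ → Set.ncard {w ∈ EvenSignedPerms n | DesD n w ⊆ properPartialSums β.parts} = _) ∧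
    (_ → Set.ncard {w ∈ EvenSignedPerms n | DesD n w ⊆ properPartialSums β.parts} = _) ∧
    (_ → Set.ncard {w ∈ EvenSignedPerms n | DesD n w ⊆ properPartialSums β.parts} = _)
  rw [ncard_evenSignedPerms_desD_subset hn1]
  obtain ⟨parts, hne, hpos, hsum⟩ := β
  obtain ⟨k, t, rfl⟩ := List.exists_cons_of_ne_nil hne
  simp only [List.headI_cons, List.tail_cons] at *
  rw [List.sum_cons] at hsum
  refine ⟨?_, ?_, fun hk => ?_⟩
  · rintro rfl
    let c : Composition n := ⟨t, fun {i} hi => hpos i hi, by omega⟩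
    have hmem (m : ℕ) : m ∈ properPartialSums (0 :: t) ↔ m = 0 ∨ m ∈ properPartialSums t := by
      have ht : t ≠ [] := by
        rintro rfl
        simp at hsum
        omega
      simp [mem_properPartialSums_cons, ht]
    have hset : {u ∈ evenWords n | DescentsDIn hn1 (properPartialSums (0 :: t)) u} =
        {u ∈ evenWords n | DescentsIn (properPartialSums c.blocks) u} := by
      ext u
      simp [DescentsDIn, DescentsIn, hmem, c]
    rw [hset, c.ncard_evenWords_descentsIn (by omega)]
    simp [c]
  · rintro rfl
    obtain ⟨b, t, rfl⟩ := List.exists_cons_of_ne_nil (show t ≠ [] by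
      rintro rfl
      simp at hsum
      omega)
    have hb : 0 < b := hpos b (by simp)
    let c : Composition n := ⟨(1 + b) :: t, fun {i} hi => by
      rcases List.mem_cons.1 hi with rfl | hi
      · omega
      · exact hpos i (by simp [hi]), by simp only [List.sum_cons] at hsum ⊢; omega⟩
    rw [ncard_evenWords_descentsDIn_of_one_mem (T := properPartialSums c.blocks) hn1,
      c.ncard_oddWords_descentsIn (by omega)]
    · rfl
    · exact fun h => by have := le_of_mem_properPartialSums_cons h; omega
    · simp [mem_properPartialSums_cons]
    · exact fun h => by have := le_of_mem_properPartialSums_cons h; omega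
    · intro m hm
      simp only [c, mem_properPartialSums_cons (k := 1), mem_properPartialSums_cons (k := b),
        mem_properPartialSums_cons (k := 1 + b)]
      constructor
      · rintro ⟨-, rfl | ⟨s, ⟨ht, rfl | ⟨r, hr, rfl⟩⟩, rfl⟩⟩
        · omega
        · exact ⟨ht, Or.inl rfl⟩
        · exact ⟨ht, Or.inr ⟨r, hr, by omega⟩⟩
      · rintro ⟨ht, rfl | ⟨r, hr, rfl⟩⟩
        · exact ⟨by simp, Or.inr ⟨b, ⟨ht, Or.inl rfl⟩, rfl⟩⟩
        · exact ⟨by simp, Or.inr ⟨b + r, ⟨ht, Or.inr ⟨r, hr, rfl⟩⟩, by omega⟩⟩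
  · let c : Composition n := ⟨k :: t, fun {i} hi => by
      rcases List.mem_cons.1 hi with rfl | hi
      · omega
      · exact hpos i hi, by rw [List.sum_cons, hsum]⟩
    rw [ncard_evenWords_descentsDIn_of_lt hn1 hk
      (fun m hm => le_of_mem_properPartialSums_cons hm)]
    exact c.ncard_posWords_descentsIn rfl
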